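/- arXiv:math/0703458 — 3 statements merged into one kernel-verified Lean document; each statement's English description precedes it below -/
import Mathlib

section
/- Assume the system is asymptotically controllable and that for each penalty coefficient ρ ≥ 1 the problem of minimizing J(u, T; x_t) = T + ε ∫_t^{t+T} L(x(s),u(s)) ds + ρ q(x(t+T)) over piecewise continuous U-valued controls u on [t, t+T] and horizons T ≥ T_min (no terminal-set constraint imposed) attains its minimum at some (ū, T̄) with trajectory x̄, where ε ∈ [0,1] is fixed. Then for every α > 0 there exists ρ > 0 such that the optimal terminal state satisfies ‖x̄(t + T̄)‖²_H ≤ α. -/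
open Set MeasureTheory Filter Topology Matrix

noncomputable section

/-- `ℝⁿ` with the Euclidean norm. -/
abbrev Vec (n : ℕ) := EuclideanSpace ℝ (Fin n)

/-- A function is piecewise continuous on a set if it is continuous off a
finite set of points. -/
def PiecewiseContinuousOn {m : ℕ} (u : ℝ → Vec m) (s : Set ℝ) : Prop :=
  ∃ D : Finset ℝ, ContinuousOn u (s \ (D : Set ℝ))

/-- The compact control box `U = {u : u_min ≤ u ≤ u_max componentwise}`. -/
def ControlBox {m : ℕ} (umin umax : Vec m) : Set (Vec m) :=
  {u | ∀ j, umin j ≤ u j ∧ u j ≤ umax j}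

/-- `x` solves `ẋ(τ) = f(x(τ), u(τ))` on the set `s`. -/
def IsTrajectoryOn {n m : ℕ} (f : Vec n → Vec m → Vec n)
    (x : ℝ → Vec n) (u : ℝ → Vec m) (s : Set ℝ) : Prop :=
  ∀ τ ∈ s, HasDerivAt x (f (x τ) (u τ)) τ

/-- The control `u` (with response `x`) is admissible at `xt` on `[t, t+T]`:
piecewise continuous, `U`-valued, solving the system from `xt`, with terminal
state in `Ω`. -/
structure IsAdmissible {n m : ℕ} (f : Vec n → Vec m → Vec n)
    (Uset : Set (Vec m)) (Ω : Set (Vec n))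
    (t T : ℝ) (xt : Vec n) (u : ℝ → Vec m) (x : ℝ → Vec n) : Prop where
  pc : PiecewiseContinuousOn u (Icc t (t + T))
  memU : ∀ s ∈ Icc t (t + T), u s ∈ Uset
  traj : IsTrajectoryOn f x u (Icc t (t + T))
  init : x t = xt
  term : x (t + T) ∈ Ω

/-- Class `𝒦` function: continuous, strictly increasing, vanishing at `0`. -/
def ClassK (φ : ℝ → ℝ) : Prop :=
  ContinuousOn φ (Ici 0) ∧ StrictMonoOn φ (Ici 0) ∧ φ 0 = 0

/-- The quadratic form `xᵀ M x`. -/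
def quadForm {k : ℕ} (M : Matrix (Fin k) (Fin k) ℝ) (x : Vec k) : ℝ :=
  ∑ i, ∑ j, x i * M i j * x j

/-- The cost `J(u, T; x_t) = T + ε ∫ₜ^{t+T} L(x,u) + ρ q(x(t+T))`. -/
def cost {n m : ℕ} (L : Vec n → Vec m → ℝ) (q : Vec n → ℝ)
    (ε ρ t T : ℝ) (x : ℝ → Vec n) (u : ℝ → Vec m) : ℝ :=
  T + ε * (∫ s in t..(t + T), L (x s) (u s)) + ρ * q (x (t + T))

/-- `(ū, T̄, x̄)` solves problem `P(t, x_t)`: it is admissible with `T̄ ≥ T_min`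
and minimizes the cost among all admissible pairs with horizon `≥ T_min`. -/
structure IsMinimizer {n m : ℕ} (f : Vec n → Vec m → Vec n)
    (Uset : Set (Vec m)) (Ω : Set (Vec n)) (L : Vec n → Vec m → ℝ) (q : Vec n → ℝ)
    (ε ρ Tmin t : ℝ) (xt : Vec n)
    (ubar : ℝ → Vec m) (Tbar : ℝ) (xbar : ℝ → Vec n) : Prop where
  hT : Tmin ≤ Tbar
  adm : IsAdmissible f Uset Ω t Tbar xt ubar xbar
  opt : ∀ (u : ℝ → Vec m) (T : ℝ) (x : ℝ → Vec n), Tmin ≤ T →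
      IsAdmissible f Uset Ω t T xt u x →
      cost L q ε ρ t Tbar xbar ubar ≤ cost L q ε ρ t T x u

/-- Stabilizing assumption: from every point of `Ω` there is a piecewise
continuous `U`-valued control on `[0,δ]` whose trajectory stays in `Ω` and
satisfies `(d/dτ) q(x_s(τ)) + L(x_s(τ), u_s(τ)) ≤ 0`. -/
def StabilizingAssumption {n m : ℕ} (f : Vec n → Vec m → Vec n)
    (Uset : Set (Vec m)) (Ω : Set (Vec n))
    (L : Vec n → Vec m → ℝ) (q : Vec n → ℝ) (δ : ℝ) : Prop :=
  ∀ x0 ∈ Ω, ∃ (us : ℝ → Vec m) (xs : ℝ → Vec n),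
    PiecewiseContinuousOn us (Icc 0 δ) ∧
    (∀ τ ∈ Icc (0:ℝ) δ, us τ ∈ Uset) ∧
    IsTrajectoryOn f xs us (Icc 0 δ) ∧ xs 0 = x0 ∧
    (∀ τ ∈ Icc (0:ℝ) δ, xs τ ∈ Ω) ∧
    (∀ τ ∈ Icc (0:ℝ) δ, ∃ dq : ℝ,
      HasDerivAt (fun s => q (xs s)) dq τ ∧ dq + L (xs τ) (us τ) ≤ 0)

/-- **Lemma 3.3.** If the system is asymptotically controllable and, for every
penalty coefficient `ρ ≥ 1`, the free-endpoint problem (no terminal-set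
constraint, i.e. terminal set `univ`) attains its minimum at `(ū_ρ, T̄_ρ)` with
trajectory `x̄_ρ`, then for every `α > 0` there is `ρ` with
`‖x̄_ρ(t + T̄_ρ)‖²_H ≤ α`. -/
theorem terminal_state_small_for_large_rho {n m : ℕ}
    (f : Vec n → Vec m → Vec n) (L₀ : ℝ)
    (hf : ContDiff ℝ 1 (fun p : Vec n × Vec m => f p.1 p.2))
    (hf0 : f 0 0 = 0) (hL₀ : 0 < L₀)
    (hlip : ∀ (x₁ x₂ : Vec n) (u : Vec m), ‖f x₁ u - f x₂ u‖ ≤ L₀ * ‖x₁ - x₂‖)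
    (umin umax : Vec m) (hU : ∀ j, umin j < 0 ∧ 0 < umax j)
    (δ Tmin : ℝ) (hδ : 0 < δ) (hTmin : δ ≤ Tmin)
    (L : Vec n → Vec m → ℝ)
    (hLC1 : ContDiff ℝ 1 (fun p : Vec n × Vec m => L p.1 p.2))
    (hL00 : L 0 0 = 0) (hLnn : ∀ x u, 0 ≤ L x u)
    (q : Vec n → ℝ) (hqC1 : ContDiff ℝ 1 q) (hq0 : q 0 = 0) (hqnn : ∀ x, 0 ≤ q x)
    (H : Matrix (Fin n) (Fin n) ℝ) (hH : H.PosDef)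
    (c : ℝ) (hc : 0 < c) (hqlb : ∀ x, c * quadForm H x ≤ q x)
    -- asymptotic controllability (from any point, at any starting time)
    (hcontr : ∀ (t0 : ℝ) (x0 : Vec n), ∀ η > (0:ℝ),
      ∃ (TD : ℝ) (uD : ℝ → Vec m) (xD : ℝ → Vec n), Tmin ≤ TD ∧
        IsAdmissible f (ControlBox umin umax) univ t0 TD x0 uD xD ∧
        ‖xD (t0 + TD)‖ < η)
    (t : ℝ) (xt : Vec n) (ε : ℝ) (hε : ε ∈ Icc (0:ℝ) 1)
    (ubar : ℝ → ℝ → Vec m) (Tbar : ℝ → ℝ) (xbar : ℝ → ℝ → Vec n)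
    -- for every `ρ ≥ 1` the free-endpoint problem attains its minimum
    (hmin : ∀ ρ : ℝ, 1 ≤ ρ → IsMinimizer f (ControlBox umin umax) univ L q
      ε ρ Tmin t xt (ubar ρ) (Tbar ρ) (xbar ρ)) :
    ∀ α > (0:ℝ), ∃ ρ : ℝ, 1 ≤ ρ ∧
      quadForm H (xbar ρ (t + Tbar ρ)) ≤ α := by
  intro α hα
  have hcα : 0 < c * α / 2 := by positivity
  obtain ⟨η, hη, hqη⟩ := Metric.continuousAt_iff.1 (hqC1.continuous.continuousAt (x := 0)) _ hcα
  obtain ⟨TD, uD, xD, hTD, hadm, hxD⟩ := hcontr t xt η hη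
  have hqD : q (xD (t + TD)) ≤ c * α / 2 := by
    have h := hqη (x := xD (t + TD)) (by simpa using hxD)
    rw [hq0, Real.dist_eq, sub_zero] at h
    exact (le_abs_self _).trans h.le
  -- the part of the comparison cost that does not depend on `ρ`
  set A : ℝ := TD + ε * ∫ s in t..(t + TD), L (xD s) (uD s) with hA
  refine ⟨max 1 (A / (c * α / 2)), le_max_left _ _, ?_⟩
  set ρ : ℝ := max 1 (A / (c * α / 2))
  have hρ1 : 1 ≤ ρ := le_max_left _ _
  have hAρ : A ≤ ρ * (c * α / 2) := (div_le_iff₀ hcα).1 (le_max_right _ _)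
  have hm := hmin ρ hρ1
  have hopt := hm.opt uD TD xD hTD hadm
  have hT0 : 0 ≤ Tbar ρ := (hδ.le.trans hTmin).trans hm.hT
  have hint : 0 ≤ ∫ s in t..(t + Tbar ρ), L (xbar ρ s) (ubar ρ s) :=
    intervalIntegral.integral_nonneg (by linarith) fun s _ => hLnn _ _
  have hεint := mul_nonneg hε.1 hint
  simp only [cost, ← hA] at hopt
  have hρ0 : 0 < ρ := by linarith
  have hq : q (xbar ρ (t + Tbar ρ)) ≤ c * α := by
    have hρq := mul_le_mul_of_nonneg_left hqD hρ0.le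
    refine le_of_mul_le_mul_left ?_ hρ0
    linarith
  exact le_of_mul_le_mul_left ((hqlb _).trans hq) hc
end
end

section
/- Suppose ε_i ≡ 0 and ρ_i ≡ ρ is constant, all arising problems P attain their minima with T̄_i ≥ T_min for all i, and the stabilizing assumption holds. Then the following alternative occurs: there exists an index j ≥ 0 such that either T̄_j ∈ [T_min, T_min + δ), or T̄_j ≥ T_min + δ and x̄ʲ(t_j) ∈ B. -/
open Set MeasureTheory Filter Topology Matrix

noncomputable section

/-- The tail of an admissible pair is admissible from the state reached along it. -/
theorem IsAdmissible.tail {n m : ℕ} {f : Vec n → Vec m → Vec n} {Uset : Set (Vec m)}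
    {Ω : Set (Vec n)} {t T : ℝ} {xt : Vec n} {u : ℝ → Vec m} {x : ℝ → Vec n}
    (h : IsAdmissible f Uset Ω t T xt u x) {d : ℝ} (hd : 0 ≤ d) :
    IsAdmissible f Uset Ω (t + d) (T - d) (x (t + d)) u x := by
  have he : t + d + (T - d) = t + T := by ring
  have hsub : Icc (t + d) (t + d + (T - d)) ⊆ Icc t (t + T) := by
    rw [he]
    exact Icc_subset_Icc_left (by linarith)
  refine ⟨?_, fun s hs => h.memU s (hsub hs), fun s hs => h.traj s (hsub hs), rfl, ?_⟩
  · obtain ⟨D, hD⟩ := h.pc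
    exact ⟨D, hD.mono (sdiff_subset_sdiff_left hsub)⟩
  · rw [he]
    exact h.term

/-- Along the tail of a pair, the cost without running cost drops by the elapsed time. -/
theorem cost_zero_tail {n m : ℕ} (L : Vec n → Vec m → ℝ) (q : Vec n → ℝ)
    (ρ t T d : ℝ) (x : ℝ → Vec n) (u : ℝ → Vec m) :
    cost L q 0 ρ (t + d) (T - d) x u = cost L q 0 ρ t T x u - d := by
  have he : t + d + (T - d) = t + T := by ring
  simp only [cost, he]
  ring

/-- **Lemma 4.1.** If `ε_i ≡ 0`, `ρ` is constant, all problems attain their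
minima (with `T̄_i ≥ T_min`) and the stabilizing assumption holds, then for some
index `j` either `T̄_j ∈ [T_min, T_min + δ)`, or `T̄_j ≥ T_min + δ` and
`x̄ʲ(t_j) ∈ B`. -/
theorem horizon_shrinks_or_B_reached {n m : ℕ}
    (f : Vec n → Vec m → Vec n) (L₀ : ℝ)
    (hf : ContDiff ℝ 1 (fun p : Vec n × Vec m => f p.1 p.2))
    (hf0 : f 0 0 = 0) (hL₀ : 0 < L₀)
    (hlip : ∀ (x₁ x₂ : Vec n) (u : Vec m), ‖f x₁ u - f x₂ u‖ ≤ L₀ * ‖x₁ - x₂‖)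
    (umin umax : Vec m) (hU : ∀ j, umin j < 0 ∧ 0 < umax j)
    (Ω : Set (Vec n)) (hΩcl : IsClosed Ω) (hΩbd : Bornology.IsBounded Ω)
    (hΩsc : SimplyConnectedSpace Ω) (hΩ0 : (0 : Vec n) ∈ Ω)
    (B : Set (Vec n)) (hBcl : IsClosed B) (hBbd : Bornology.IsBounded B)
    (hBsc : SimplyConnectedSpace B) (hB0 : (0 : Vec n) ∈ B)
    (δ Tmin : ℝ) (hδ : 0 < δ) (hTmin : δ ≤ Tmin)
    (L : Vec n → Vec m → ℝ)
    (hLC1 : ContDiff ℝ 1 (fun p : Vec n × Vec m => L p.1 p.2))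
    (hL00 : L 0 0 = 0) (hLnn : ∀ x u, 0 ≤ L x u)
    (q : Vec n → ℝ) (hqC1 : ContDiff ℝ 1 q) (hq0 : q 0 = 0) (hqnn : ∀ x, 0 ≤ q x)
    (H : Matrix (Fin n) (Fin n) ℝ) (hH : H.PosDef)
    (c : ℝ) (hc : 0 < c) (hqlb : ∀ x, c * quadForm H x ≤ q x)
    (ρ : ℝ) (hρ : 1 ≤ ρ)
    (hstab : StabilizingAssumption f (ControlBox umin umax) Ω L q δ)
    (xstar : ℝ → Vec n)
    (ubar : ℕ → ℝ → Vec m) (Tbar : ℕ → ℝ) (xbar : ℕ → ℝ → Vec n)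
    (hmin : ∀ i : ℕ, IsMinimizer f (ControlBox umin umax) Ω L q 0 ρ
      Tmin ((i : ℝ) * δ) (xstar ((i : ℝ) * δ)) (ubar i) (Tbar i) (xbar i))
    (hloop : ∀ i : ℕ, ∀ σ ∈ Icc (0:ℝ) δ,
      xstar ((i : ℝ) * δ + σ) = xbar i ((i : ℝ) * δ + σ)) :
    ∃ j : ℕ, Tbar j < Tmin + δ ∨
      (Tmin + δ ≤ Tbar j ∧ xbar j ((j : ℝ) * δ) ∈ B) := by
  by_contra! hno
  have hlong : ∀ j, Tmin + δ ≤ Tbar j := fun j => (hno j).1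
  set V : ℕ → ℝ := fun i => cost L q 0 ρ ((i : ℝ) * δ) (Tbar i) (xbar i) (ubar i) with hV
  have hstep : ∀ i, V (i + 1) ≤ V i - δ := by
    intro i
    have ht : ((i + 1 : ℕ) : ℝ) * δ = (i : ℝ) * δ + δ := by push_cast; ring
    have hopt := (hmin (i + 1)).opt (ubar i) (Tbar i - δ) (xbar i) (by linarith [hlong i])
    rw [ht, hloop i δ ⟨hδ.le, le_rfl⟩, cost_zero_tail] at hopt
    simpa only [hV, ht] using hopt ((hmin i).adm.tail hδ.le)
  have hbound : ∀ i : ℕ, V i ≤ V 0 - i * δ := by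
    intro i
    induction i with
    | zero => simp
    | succ k ih =>
      have := hstep k
      push_cast
      linarith
  have hnonneg : ∀ i, 0 ≤ V i := by
    intro i
    have hq := mul_nonneg (zero_le_one.trans hρ) (hqnn (xbar i ((i : ℝ) * δ + Tbar i)))
    simp only [hV, cost]
    linarith [hlong i]
  obtain ⟨N, hN⟩ := exists_nat_gt (V 0 / δ)
  rw [div_lt_iff₀ hδ] at hN
  linarith [hbound N, hnonneg N]
end
end

section
/- There exists a number α > 0 such that, with Ω = {x ∈ ℝⁿ : xᵀHx ≤ α}, every solution x_s of ẋ_s = f(x_s, K x_s) with x_s(0) ∈ Ω satisfies: (1) (d/dτ) q(x_s(τ)) + L(x_s(τ), K x_s(τ)) ≤ 0 for all τ ≥ 0; (2) Ω is positively invariant and contained in the region of attraction of the origin, i.e. x_s(τ) ∈ Ω for all τ ≥ 0 and x_s(τ) → 0 as τ → ∞; (3) the feedback control satisfies the constraints: K x_s(τ) ∈ U for all τ ≥ 0. -/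
open Set MeasureTheory Filter Topology Matrix

noncomputable section

/-- Multiplication of a vector in `ℝˡ` by a `k × l` matrix, as a map
`Vec l → Vec k`. -/
def mvec {k l : ℕ} (M : Matrix (Fin k) (Fin l) ℝ) (x : Vec l) : Vec k :=
  (EuclideanSpace.equiv (Fin k) ℝ).symm (M.mulVec (EuclideanSpace.equiv (Fin l) ℝ x))

/-- `mvec M` as a continuous linear map. -/
def mvecCLM {k l : ℕ} (M : Matrix (Fin k) (Fin l) ℝ) : Vec l →L[ℝ] Vec k :=
  LinearMap.toContinuousLinearMap
    { toFun := mvec M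
      map_add' := fun x y => by simp [mvec, Matrix.mulVec_add]
      map_smul' := fun c x => by simp [mvec, Matrix.mulVec_smul] }

theorem mvecCLM_apply {k l : ℕ} (M : Matrix (Fin k) (Fin l) ℝ) (x : Vec l) :
    mvecCLM M x = mvec M x := rfl

theorem ofLp_mvec {k l : ℕ} (M : Matrix (Fin k) (Fin l) ℝ) (x : Vec l) :
    (mvec M x).ofLp = M *ᵥ x.ofLp := rfl

theorem quadForm_eq_dotProduct {k : ℕ} (M : Matrix (Fin k) (Fin k) ℝ) (x : Vec k) :
    quadForm M x = x.ofLp ⬝ᵥ M *ᵥ x.ofLp := by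
  simp [quadForm, dotProduct, Matrix.mulVec, Finset.mul_sum, mul_assoc]

theorem inner_mvec {k l : ℕ} (M : Matrix (Fin k) (Fin l) ℝ) (x : Vec k) (y : Vec l) :
    inner ℝ x (mvec M y) = x.ofLp ⬝ᵥ M *ᵥ y.ofLp := by
  rw [EuclideanSpace.inner_eq_star_dotProduct, ofLp_mvec, dotProduct_comm]
  simp

theorem quadForm_eq_inner {k : ℕ} (M : Matrix (Fin k) (Fin k) ℝ) (x : Vec k) :
    quadForm M x = inner ℝ x (mvecCLM M x) := by
  rw [quadForm_eq_dotProduct, mvecCLM_apply, inner_mvec]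

theorem inner_mvec_comm_of_isHermitian {k : ℕ} {M : Matrix (Fin k) (Fin k) ℝ}
    (hM : M.IsHermitian) (x y : Vec k) :
    inner ℝ x (mvec M y) = inner ℝ y (mvec M x) := by
  have hT : Mᵀ = M := by simpa [Matrix.conjTranspose_eq_transpose_of_trivial] using hM.eq
  rw [inner_mvec, inner_mvec, Matrix.dotProduct_mulVec, ← Matrix.mulVec_transpose, hT,
    dotProduct_comm]

/-- A solution of the Lyapunov equation decreases along the linear flow at the rate of the cost. -/
theorem two_inner_mvec_of_lyapunov {n m : ℕ} {F H W : Matrix (Fin n) (Fin n) ℝ}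
    {R : Matrix (Fin m) (Fin m) ℝ} {K : Matrix (Fin m) (Fin n) ℝ}
    (hH : H.IsHermitian) (hLyap : Fᵀ * H + H * F = -(W + Kᵀ * R * K)) (x : Vec n) :
    2 * inner ℝ (mvec F x) (mvec H x) = -(quadForm W x + quadForm R (mvec K x)) := by
  have key := congrArg (fun M => x.ofLp ⬝ᵥ M *ᵥ x.ofLp) hLyap
  simp only [Matrix.add_mulVec, Matrix.neg_mulVec, dotProduct_add, dotProduct_neg] at key
  have h1 : x.ofLp ⬝ᵥ (Fᵀ * H) *ᵥ x.ofLp = inner ℝ (mvec F x) (mvec H x) := by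
    rw [inner_mvec, ofLp_mvec, ← Matrix.mulVec_mulVec, Matrix.dotProduct_mulVec,
      Matrix.vecMul_transpose]
  have h2 : x.ofLp ⬝ᵥ (H * F) *ᵥ x.ofLp = inner ℝ (mvec F x) (mvec H x) := by
    rw [inner_mvec_comm_of_isHermitian hH, inner_mvec, ofLp_mvec, Matrix.mulVec_mulVec]
  have h3 : x.ofLp ⬝ᵥ (Kᵀ * R * K) *ᵥ x.ofLp = quadForm R (mvec K x) := by
    rw [quadForm_eq_dotProduct, ofLp_mvec, ← Matrix.mulVec_mulVec, ← Matrix.mulVec_mulVec,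
      Matrix.dotProduct_mulVec, Matrix.vecMul_transpose]
  rw [h1, h2, h3, ← quadForm_eq_dotProduct] at key
  linarith

theorem quadForm_pos {k : ℕ} {M : Matrix (Fin k) (Fin k) ℝ} (hM : M.PosDef) {x : Vec k}
    (hx : x ≠ 0) : 0 < quadForm M x := by
  have h := hM.dotProduct_mulVec_pos (x := x.ofLp) (by simpa using hx)
  rw [quadForm_eq_dotProduct]
  simpa using h

theorem quadForm_nonneg {k : ℕ} {M : Matrix (Fin k) (Fin k) ℝ} (hM : M.PosDef) (x : Vec k) :
    0 ≤ quadForm M x := by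
  rcases eq_or_ne x 0 with rfl | hx
  · simp [quadForm]
  · exact (quadForm_pos hM hx).le

theorem quadForm_smul {k : ℕ} (M : Matrix (Fin k) (Fin k) ℝ) (c : ℝ) (x : Vec k) :
    quadForm M (c • x) = c ^ 2 * quadForm M x := by
  simp only [quadForm_eq_inner, map_smul, inner_smul_left, inner_smul_right]
  simp
  ring

theorem continuous_quadForm {k : ℕ} (M : Matrix (Fin k) (Fin k) ℝ) :
    Continuous (quadForm M) := by
  have : quadForm M = fun x => inner ℝ x (mvecCLM M x) := funext (quadForm_eq_inner M)
  rw [this]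
  fun_prop

theorem exists_norm_sq_le_quadForm {k : ℕ} {M : Matrix (Fin k) (Fin k) ℝ} (hM : M.PosDef) :
    ∃ c > 0, ∀ x : Vec k, c * ‖x‖ ^ 2 ≤ quadForm M x := by
  obtain ⟨c, hc, hle⟩ := (isCompact_sphere (0 : Vec k) 1).exists_forall_le'
    (continuous_quadForm M).continuousOn (a := 0) fun x hx =>
      quadForm_pos hM (ne_zero_of_mem_unit_sphere ⟨x, hx⟩)
  refine ⟨c, hc, fun x => ?_⟩
  rcases eq_or_ne x 0 with rfl | hx
  · simp [quadForm]
  have hn : ‖x‖ ≠ 0 := norm_ne_zero_iff.mpr hx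
  have h := hle (‖x‖⁻¹ • x) (by simp [norm_smul, hn])
  rw [quadForm_smul, inv_pow, inv_mul_eq_div, le_div_iff₀ (by positivity)] at h
  exact h

theorem quadForm_le_norm_sq {k : ℕ} (M : Matrix (Fin k) (Fin k) ℝ) (x : Vec k) :
    quadForm M x ≤ ‖mvecCLM M‖ * ‖x‖ ^ 2 := by
  rw [quadForm_eq_inner]
  calc inner ℝ x (mvecCLM M x) ≤ ‖x‖ * ‖mvecCLM M x‖ := real_inner_le_norm _ _
    _ ≤ ‖x‖ * (‖mvecCLM M‖ * ‖x‖) := by gcongr; exact (mvecCLM M).le_opNorm x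
    _ = ‖mvecCLM M‖ * ‖x‖ ^ 2 := by ring

theorem hasDerivAt_quadForm {k : ℕ} {M : Matrix (Fin k) (Fin k) ℝ} (hM : M.IsHermitian)
    {x : ℝ → Vec k} {x' : Vec k} {t : ℝ} (hx : HasDerivAt x x' t) :
    HasDerivAt (fun s => quadForm M (x s)) (2 * inner ℝ x' (mvec M (x t))) t := by
  simp only [quadForm_eq_inner]
  have h := hx.inner ℝ ((mvecCLM M).hasFDerivAt.comp_hasDerivAt t hx)
  refine h.congr_deriv ?_
  simp only [Function.comp, mvecCLM_apply]
  rw [inner_mvec_comm_of_isHermitian hM (x t)]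
  ring

/-- The closed-loop vector field `x ↦ f(x, K x)` has derivative `A + B K` at the origin. -/
theorem hasFDerivAt_closedLoop {n m : ℕ} {f : Vec n → Vec m → Vec n}
    (hf : DifferentiableAt ℝ (fun p : Vec n × Vec m => f p.1 p.2) (0, 0))
    {A : Matrix (Fin n) (Fin n) ℝ} {B : Matrix (Fin n) (Fin m) ℝ}
    (hA : ∀ v : Vec n,
      fderiv ℝ (fun p : Vec n × Vec m => f p.1 p.2) (0, 0) (v, 0) = mvec A v)
    (hB : ∀ w : Vec m,
      fderiv ℝ (fun p : Vec n × Vec m => f p.1 p.2) (0, 0) (0, w) = mvec B w)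
    (K : Matrix (Fin m) (Fin n) ℝ) :
    HasFDerivAt (fun x => f x (mvec K x)) (mvecCLM (A + B * K)) 0 := by
  have hlin : HasFDerivAt (fun x : Vec n => (x, mvecCLM K x))
      ((ContinuousLinearMap.id ℝ (Vec n)).prod (mvecCLM K)) 0 :=
    (hasFDerivAt_id _).prodMk (mvecCLM K).hasFDerivAt
  have h0 : ((0 : Vec n), mvecCLM K 0) = (0, 0) := by simp
  have hcomp := HasFDerivAt.comp (0 : Vec n) (by rw [h0]; exact hf.hasFDerivAt) hlin
  refine hcomp.congr_fderiv ?_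
  ext1 x
  have hsplit : (x, mvecCLM K x) = (x, 0) + (0, mvecCLM K x) := by simp
  simp only [ContinuousLinearMap.comp_apply, ContinuousLinearMap.prod_apply,
    ContinuousLinearMap.id_apply]
  rw [hsplit, map_add, hA, hB]
  apply (WithLp.ofLp_injective 2)
  simp [mvecCLM_apply, ofLp_mvec, Matrix.add_mulVec]

theorem eventually_mvec_mem_controlBox {n m : ℕ} {umin umax : Vec m}
    (hU : ∀ j, umin j < 0 ∧ 0 < umax j) (K : Matrix (Fin m) (Fin n) ℝ) :
    ∀ᶠ x in 𝓝 (0 : Vec n), mvec K x ∈ ControlBox umin umax := by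
  refine eventually_all.mpr fun j => ?_
  have hc : ContinuousAt (fun x : Vec n => mvecCLM K x j) 0 := by fun_prop
  have h0 : mvecCLM K 0 j = 0 := by simp
  filter_upwards [hc.eventually_const_lt (h0.symm ▸ (hU j).1),
    hc.eventually_lt_const (h0.symm ▸ (hU j).2)] with x h1 h2
  exact ⟨h1.le, h2.le⟩

/-- Near the origin, the scaled Lyapunov function `k xᵀHx` dissipates the running cost along the
nonlinear closed loop. -/
theorem eventually_dissipation {n m : ℕ} {g : Vec n → Vec n} {F H W : Matrix (Fin n) (Fin n) ℝ}
    {R : Matrix (Fin m) (Fin m) ℝ} {K : Matrix (Fin m) (Fin n) ℝ}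
    (hg : HasFDerivAt g (mvecCLM F) 0) (hg0 : g 0 = 0) (hW : W.PosDef) (hR : R.PosDef)
    {k : ℝ} (hk : 1 < k) (hH : H.IsHermitian)
    (hLyap : Fᵀ * H + H * F = -(W + Kᵀ * R * K)) :
    ∀ᶠ x in 𝓝 (0 : Vec n),
      k * (2 * inner ℝ (g x) (mvec H x)) + (quadForm W x + quadForm R (mvec K x)) ≤ 0 := by
  obtain ⟨c, hc, hcW⟩ := exists_norm_sq_le_quadForm hW
  have hε : 0 < (k - 1) * c / (2 * k * (‖mvecCLM H‖ + 1)) := by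
    have : 0 < k - 1 := by linarith
    positivity
  filter_upwards [hg.isLittleO.def hε] with x hx
  simp only [hg0, sub_zero] at hx
  set ε := (k - 1) * c / (2 * k * (‖mvecCLM H‖ + 1)) with hεdef
  have hε' : 2 * k * (‖mvecCLM H‖ + 1) * ε = (k - 1) * c := by
    rw [hεdef]; field_simp
  have hr : inner ℝ (g x - mvecCLM F x) (mvec H x) ≤ ε * (‖mvecCLM H‖ + 1) * ‖x‖ ^ 2 :=
    calc inner ℝ (g x - mvecCLM F x) (mvec H x)
        ≤ ‖g x - mvecCLM F x‖ * ‖mvecCLM H x‖ := real_inner_le_norm _ _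
      _ ≤ (ε * ‖x‖) * ((‖mvecCLM H‖ + 1) * ‖x‖) := by
          gcongr
          exact ((mvecCLM H).le_opNorm x).trans (by gcongr; linarith)
      _ = ε * (‖mvecCLM H‖ + 1) * ‖x‖ ^ 2 := by ring
  rw [inner_sub_left, mvecCLM_apply] at hr
  have hL := two_inner_mvec_of_lyapunov hH hLyap x
  have hQ : c * ‖x‖ ^ 2 ≤ quadForm W x + quadForm R (mvec K x) := by
    linarith [hcW x, quadForm_nonneg hR (mvec K x)]
  have h1 := mul_le_mul_of_nonneg_left hr (by linarith : (0 : ℝ) ≤ 2 * k)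
  have h2 := mul_le_mul_of_nonneg_left hQ (by linarith : (0 : ℝ) ≤ k - 1)
  have h3 : 2 * k * (ε * (‖mvecCLM H‖ + 1) * ‖x‖ ^ 2) = (k - 1) * (c * ‖x‖ ^ 2) := by
    rw [← mul_assoc (k - 1), ← hε']; ring
  have h4 : 2 * k * inner ℝ (mvec F x) (mvec H x)
      = -k * (quadForm W x + quadForm R (mvec K x)) := by
    rw [mul_right_comm, hL]; ring
  nlinarith

/-- A function with `v' ≤ -c v` on `[0, ∞)` decays exponentially. -/
theorem le_mul_exp_neg_of_deriv_le {v v' : ℝ → ℝ} {c : ℝ}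
    (hv : ∀ t, 0 ≤ t → HasDerivAt v (v' t) t) (hle : ∀ t, 0 ≤ t → v' t ≤ -c * v t)
    {t : ℝ} (ht : 0 ≤ t) : v t ≤ v 0 * Real.exp (-(c * t)) := by
  have hd : ∀ s, 0 ≤ s → HasDerivAt (fun s => v s * Real.exp (c * s))
      (v' s * Real.exp (c * s) + v s * (Real.exp (c * s) * c)) s := fun s hs =>
    (hv s hs).mul (by simpa using ((hasDerivAt_id s).const_mul c).exp)
  have hanti : AntitoneOn (fun s => v s * Real.exp (c * s)) (Ici 0) := by
    refine antitoneOn_of_hasDerivWithinAt_nonpos (convex_Ici 0)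
      (fun s hs => (hd s hs).continuousAt.continuousWithinAt)
      (fun s hs => (hd s (interior_subset hs)).hasDerivWithinAt) fun s hs => ?_
    nlinarith [hle s (interior_subset hs), Real.exp_pos (c * s)]
  have h := hanti (mem_Ici.mpr le_rfl) (mem_Ici.mpr ht) ht
  simp only [mul_zero, Real.exp_zero, mul_one] at h
  rw [Real.exp_neg, ← div_eq_mul_inv, le_div_iff₀ (Real.exp_pos _)]
  exact h

/-- **Lemma 5.1.** For the quadratic cost `L(x,u) = xᵀWx + uᵀRu`,
`q(x) = k xᵀHx` with `k > 1`, a stabilizing gain `K` (so that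
`A_K = A + BK` is exponentially stable, `A = D_x f(0,0)`, `B = D_u f(0,0)`) and
`H` the solution of the Lyapunov equation, there exists `α > 0` such that, with
`Ω = {x : xᵀHx ≤ α}`, every solution of `ẋ_s = f(x_s, K x_s)` starting in `Ω`
satisfies the dissipation inequality, stays in `Ω` and converges to `0`, and
the feedback control respects the control constraints. -/
theorem quadratic_terminal_region {n m : ℕ}
    (f : Vec n → Vec m → Vec n)
    (hf : ContDiff ℝ 1 (fun p : Vec n × Vec m => f p.1 p.2))
    (hf0 : f 0 0 = 0)
    (umin umax : Vec m) (hU : ∀ j, umin j < 0 ∧ 0 < umax j)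
    (W : Matrix (Fin n) (Fin n) ℝ) (hW : W.PosDef)
    (R : Matrix (Fin m) (Fin m) ℝ) (hR : R.PosDef)
    (k : ℝ) (hk : 1 < k)
    (A : Matrix (Fin n) (Fin n) ℝ) (Bm : Matrix (Fin n) (Fin m) ℝ)
    -- `A` and `B` are the partial derivatives of `f` at `(0,0)`
    (hA : ∀ v : Vec n,
      fderiv ℝ (fun p : Vec n × Vec m => f p.1 p.2) (0, 0) (v, 0) = mvec A v)
    (hB : ∀ w : Vec m,
      fderiv ℝ (fun p : Vec n × Vec m => f p.1 p.2) (0, 0) (0, w) = mvec Bm w)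
    (K : Matrix (Fin m) (Fin n) ℝ)
    -- `A_K = A + B K` is exponentially stable
    (hstable : ∀ μ ∈ spectrum ℂ ((A + Bm * K).map (fun x : ℝ => (x : ℂ))), μ.re < 0)
    (H : Matrix (Fin n) (Fin n) ℝ) (hH : H.PosDef)
    -- `H` solves the Lyapunov equation
    (hLyap : (A + Bm * K)ᵀ * H + H * (A + Bm * K) = -(W + Kᵀ * R * K)) :
    ∃ α > (0:ℝ), ∀ xs : ℝ → Vec n,
      quadForm H (xs 0) ≤ α →
      (∀ τ ∈ Ici (0:ℝ), HasDerivAt xs (f (xs τ) (mvec K (xs τ))) τ) →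
      ((∀ τ ∈ Ici (0:ℝ), ∃ dq : ℝ,
          HasDerivAt (fun s => k * quadForm H (xs s)) dq τ ∧
          dq + (quadForm W (xs τ) + quadForm R (mvec K (xs τ))) ≤ 0) ∧
        (∀ τ ∈ Ici (0:ℝ), quadForm H (xs τ) ≤ α) ∧
        Tendsto xs atTop (𝓝 0) ∧
        (∀ τ ∈ Ici (0:ℝ), mvec K (xs τ) ∈ ControlBox umin umax)) := by
  have hg := hasFDerivAt_closedLoop (hf.differentiable one_ne_zero (0, 0)) hA hB K
  have hm0 : mvec K 0 = 0 := map_zero (mvecCLM K)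
  obtain ⟨δ, hδ, hball⟩ := Metric.eventually_nhds_iff.mp
    ((eventually_dissipation hg (by rw [hm0, hf0]) hW hR hk hH.isHermitian hLyap).and
      (eventually_mvec_mem_controlBox hU K))
  obtain ⟨cW, hcW, hW'⟩ := exists_norm_sq_le_quadForm hW
  obtain ⟨cH, hcH, hH'⟩ := exists_norm_sq_le_quadForm hH
  set α := cH * (δ / 2) ^ 2 with hα
  have hαpos : 0 < α := by positivity
  have hnear : ∀ x : Vec n, quadForm H x ≤ α → dist x 0 < δ := fun x hx => by
    have h1 : ‖x‖ ^ 2 ≤ (δ / 2) ^ 2 := le_of_mul_le_mul_left ((hH' x).trans hx) hcH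
    rw [dist_zero_right]
    linarith [(abs_le.mp (abs_le_of_sq_le_sq h1 (by positivity))).2]
  refine ⟨α, hαpos, fun xs h0 hxs => ?_⟩
  have hderiv : ∀ τ, 0 ≤ τ → HasDerivAt (fun s => quadForm H (xs s))
      (2 * inner ℝ (f (xs τ) (mvec K (xs τ))) (mvec H (xs τ))) τ := fun τ hτ =>
    hasDerivAt_quadForm hH.isHermitian (hxs τ hτ)
  have hdecay : ∀ x : Vec n, quadForm H x ≤ α →
      k * (2 * inner ℝ (f x (mvec K x)) (mvec H x)) ≤ -(cW * ‖x‖ ^ 2) := fun x hx => by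
    linarith [(hball (hnear x hx)).1, hW' x, quadForm_nonneg hR (mvec K x)]
  have hinv : ∀ τ, 0 ≤ τ → quadForm H (xs τ) ≤ α := fun τ hτ => by
    refine image_le_of_deriv_right_lt_deriv_boundary (a := 0) (b := τ) (B := fun _ => α)
      (B' := fun _ => 0) (fun s hs => (hderiv s hs.1).continuousAt.continuousWithinAt)
      (fun s hs => (hderiv s hs.1).hasDerivWithinAt) h0 (fun s => hasDerivAt_const s α)
      (fun s _ hs => ?_) ⟨hτ, le_rfl⟩
    have hne : xs s ≠ 0 := fun h => by
      rw [h] at hs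
      simp [quadForm] at hs
      exact hαpos.ne hs
    have hpos : 0 < cW * ‖xs s‖ ^ 2 := by positivity
    have := hdecay (xs s) hs.le
    by_contra! hge
    nlinarith
  refine ⟨fun τ hτ => ⟨_, (hderiv τ hτ).const_mul k, (hball (hnear _ (hinv τ hτ))).1⟩, hinv, ?_,
    fun τ hτ => (hball (hnear _ (hinv τ hτ))).2⟩
  set c := cW / (k * (‖mvecCLM H‖ + 1)) with hc
  have hcpos : 0 < c := by positivity
  have hrate : ∀ τ, 0 ≤ τ → 2 * inner ℝ (f (xs τ) (mvec K (xs τ))) (mvec H (xs τ))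
      ≤ -c * quadForm H (xs τ) := fun τ hτ => by
    have h1 := hdecay (xs τ) (hinv τ hτ)
    have h2 : quadForm H (xs τ) ≤ (‖mvecCLM H‖ + 1) * ‖xs τ‖ ^ 2 :=
      (quadForm_le_norm_sq H (xs τ)).trans (by gcongr; linarith)
    have h3 := mul_le_mul_of_nonneg_left h2 (by positivity : 0 ≤ k * c)
    have h4 : k * c * ((‖mvecCLM H‖ + 1) * ‖xs τ‖ ^ 2) = cW * ‖xs τ‖ ^ 2 := by
      rw [hc]; field_simp
    refine le_of_mul_le_mul_left ?_ (by linarith : 0 < k)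
    linarith
  have hexp : ∀ τ, 0 ≤ τ → ‖xs τ‖ ^ 2 ≤ cH⁻¹ * (quadForm H (xs 0) * Real.exp (-(c * τ))) :=
    fun τ hτ => by
      rw [le_inv_mul_iff₀ hcH]
      exact (hH' _).trans (le_mul_exp_neg_of_deriv_le hderiv hrate hτ)
  have hlim : Tendsto (fun τ => cH⁻¹ * (quadForm H (xs 0) * Real.exp (-(c * τ)))) atTop (𝓝 0) := by
    have h := Real.tendsto_exp_neg_atTop_nhds_zero.comp (tendsto_id.const_mul_atTop hcpos)
    simpa using (h.const_mul (quadForm H (xs 0))).const_mul cH⁻¹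
  have hsq : Tendsto (fun τ => ‖xs τ‖ ^ 2) atTop (𝓝 0) :=
    squeeze_zero' (Eventually.of_forall fun τ => by positivity)
      ((eventually_ge_atTop 0).mono hexp) hlim
  rw [tendsto_zero_iff_norm_tendsto_zero]
  simpa [Real.sqrt_sq] using hsq.sqrt
end
end
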